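/- Let P be a finite poset and suppose b is an older sibling of a (with a ≠ b, a and b incomparable). Let V_{a,b} be the endomorphism sending a to b and fixing everything else. Then for any two automorphisms φ, φ′ of P with V_{a,b} ∘ φ = V_{a,b} ∘ φ′, the automorphisms φ and φ′ agree on every element z with φ(z) ∉ {a, b}; consequently each endomorphism of the form V_{a,b} ∘ φ arises from at most two automorphisms φ. -/

import Mathlib

/-- If `b` is an older sibling of `a` and `V_{a,b}` is the endomorphism sending `a`
to `b` and fixing everything else, then automorphisms `φ, φ'` with
`V_{a,b} ∘ φ = V_{a,b} ∘ φ'` agree on every `z` with `φ z ∉ {a, b}`; consequently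
each endomorphism of the form `V_{a,b} ∘ φ` arises from at most two automorphisms. -/
theorem olderSibling_fiber_le_two
    (P : Type*) [PartialOrder P] [Fintype P] [DecidableEq P] (a b : P)
    (hne : a ≠ b) (hinc : ¬ a ≤ b ∧ ¬ b ≤ a)
    (hdown : ∀ z : P, z ⋖ a → z ⋖ b) (hup : ∀ z : P, a ⋖ z → b ⋖ z) :
    (∀ φ φ' : P ≃o P,
        ((fun z : P => if z = a then b else z) ∘ ⇑φ
          = (fun z : P => if z = a then b else z) ∘ ⇑φ') →
        ∀ z : P, φ z ≠ a → φ z ≠ b → φ z = φ' z) ∧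
    (∀ g : P → P,
        Nat.card {φ : P ≃o P //
          (fun z : P => if z = a then b else z) ∘ ⇑φ = g} ≤ 2) := by
  constructor
  · intro φ φ' h z hza hzb
    have hz := congrFun h z
    simp only [Function.comp_apply] at hz
    grind
  · intro g
    by_cases hg : Nonempty {φ : P ≃o P // (fun z : P => if z = a then b else z) ∘ ⇑φ = g}
    · obtain ⟨φ₀, h₀⟩ := hg
      suffices hinj : Function.Injective
          (fun φ : {φ : P ≃o P // (fun z : P => if z = a then b else z) ∘ ⇑φ = g} =>
            decide (φ.1 (φ₀.symm a) = a)) by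
        simpa using Nat.card_le_card_of_injective _ hinj
      rintro ⟨φ, h⟩ ⟨φ', h'⟩ heq
      have heq : φ (φ₀.symm a) = a ↔ φ' (φ₀.symm a) = a := by simpa using heq
      have hcollapse (ψ : P ≃o P) (hψ : (fun z : P => if z = a then b else z) ∘ ⇑ψ = g)
          (z : P) : (if ψ z = a then b else ψ z) = if φ₀ z = a then b else φ₀ z :=
        (congrFun hψ z).trans (congrFun h₀ z).symm
      have hφ := hcollapse φ h
      have hφ' := hcollapse φ' h'
      have hsymm : φ₀.symm a ≠ φ₀.symm b := φ₀.symm.injective.ne hne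
      have hφne := φ.injective.ne hsymm
      have hφ'ne := φ'.injective.ne hsymm
      have haa := φ₀.apply_symm_apply a
      have hbb := φ₀.apply_symm_apply b
      refine Subtype.ext (OrderIso.ext (funext fun z => ?_))
      change φ z = φ' z
      by_cases hza : φ₀ z = a
      · obtain rfl : z = φ₀.symm a := φ₀.injective (hza.trans haa.symm)
        grind
      · by_cases hzb : φ₀ z = b
        · obtain rfl : z = φ₀.symm b := φ₀.injective (hzb.trans hbb.symm)
          have := hφ (φ₀.symm a)
          have := hφ' (φ₀.symm a)
          grind
        · grind
    · rw [not_nonempty_iff] at hg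
      simp
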